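/- arXiv:2111.05749 — 6 statements merged into one kernel-verified Lean document; each statement's English description precedes it below -/
import Mathlib

section
/- Let p be a prime, A ∈ ℤ^{m×n}, and b ∈ ℤ^m. Then exactly one of the following holds: either the system Ax = b has a p-adic solution x, or there exists y ∈ ℝ^m such that yᵀA is an integral vector and yᵀb is not a p-adic rational; and these two alternatives never hold simultaneously. -/
open Finset

/-- A real number is `p`-adic if it has the form `a / p^k` for integers `a, k`, `k ≥ 0`. -/
def IsPadic (p : ℕ) (r : ℝ) : Prop := ∃ (a : ℤ) (k : ℕ), r = (a : ℝ) / (p : ℝ) ^ k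

lemma isPadic_sum {p : ℕ} (hp : p.Prime) {n : ℕ} (c : Fin n → ℤ) (x : Fin n → ℝ)
    (hx : ∀ j, IsPadic p (x j)) : IsPadic p (∑ j, (c j : ℝ) * x j) := by
  have hp0 : (p : ℝ) ≠ 0 := by exact_mod_cast hp.ne_zero
  refine Finset.sum_induction _ (IsPadic p) ?_ ⟨0, 0, by simp⟩ ?_
  · rintro _ _ ⟨a, k, rfl⟩ ⟨a', k', rfl⟩
    refine ⟨a * p ^ k' + a' * p ^ k, k + k', ?_⟩
    push_cast
    rw [pow_add]
    field_simp
  · intro j _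
    obtain ⟨a, k, h⟩ := hx j
    refine ⟨c j * a, k, ?_⟩
    rw [h]; push_cast; ring

/-- Separation of a point from a subgroup of `ℤ^m` by a rational vector. -/
lemma separate {m : ℕ} (N : AddSubgroup (Fin m → ℤ)) (b : Fin m → ℤ) (hb : b ∉ N) :
    ∃ y : Fin m → ℚ, (∀ v ∈ N, ∃ c : ℤ, ∑ i, y i * (v i : ℚ) = c) ∧
      ¬ ∃ c : ℤ, ∑ i, y i * (b i : ℚ) = c := by
  have hne : (QuotientAddGroup.mk b : (Fin m → ℤ) ⧸ N) ≠ 0 := by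
    rwa [Ne, QuotientAddGroup.eq_zero_iff]
  obtain ⟨φ, hφ⟩ := CharacterModule.exists_character_apply_ne_zero_of_ne_zero hne
  have hy : ∀ i : Fin m, ∃ r : ℚ, (r : AddCircle (1 : ℚ)) =
      φ (QuotientAddGroup.mk (Pi.single i 1)) :=
    fun i => QuotientAddGroup.mk_surjective _
  choose y hy using hy
  have key : ∀ v : Fin m → ℤ, φ (QuotientAddGroup.mk v) =
      ((∑ i, y i * (v i : ℚ) : ℚ) : AddCircle (1 : ℚ)) := by
    intro v
    let ψ : (Fin m → ℤ) →+ AddCircle (1 : ℚ) :=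
      (show ((Fin m → ℤ) ⧸ N) →+ AddCircle (1 : ℚ) from φ).comp (QuotientAddGroup.mk' N)
    have h1 : ψ v = ∑ i, v i • ψ (Pi.single i 1) := by
      conv_lhs => rw [← Finset.univ_sum_single v]
      rw [map_sum]
      refine Finset.sum_congr rfl fun i _ => ?_
      rw [← map_zsmul, ← Pi.single_smul]
      simp
    have h2 : ∀ i, ψ (Pi.single i 1) = (y i : AddCircle (1 : ℚ)) := fun i => (hy i).symm
    have h3 : ψ v = φ (QuotientAddGroup.mk v) := rfl
    rw [← h3, h1]
    simp only [h2]
    have h4 : ((∑ i, y i * (v i : ℚ) : ℚ) : AddCircle (1 : ℚ)) =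
        QuotientAddGroup.mk' (AddSubgroup.zmultiples (1 : ℚ)) (∑ i, y i * (v i : ℚ)) := rfl
    rw [h4, map_sum]
    refine Finset.sum_congr rfl fun i _ => ?_
    rw [mul_comm, ← zsmul_eq_mul, map_zsmul]
    rfl
  have hz : ∀ r : ℚ, (r : AddCircle (1 : ℚ)) = 0 ↔ ∃ c : ℤ, r = c := by
    intro r
    rw [AddCircle.coe_eq_zero_iff]
    simp [eq_comm]
  refine ⟨y, fun v hv => ?_, fun h => hφ ?_⟩
  · rw [← hz, ← key, (QuotientAddGroup.eq_zero_iff v).2 hv]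
    exact map_zero φ
  · rw [key]; exact (hz _).2 h

theorem theorem_of_the_alternative {m n : ℕ} (p : ℕ) (hp : p.Prime)
    (A : Matrix (Fin m) (Fin n) ℤ) (b : Fin m → ℤ) :
    Xor'
      (∃ x : Fin n → ℝ, (∀ j, IsPadic p (x j)) ∧
        ∀ i, ∑ j, (A i j : ℝ) * x j = (b i : ℝ))
      (∃ y : Fin m → ℝ, (∀ j, ∃ c : ℤ, ∑ i, y i * (A i j : ℝ) = (c : ℝ)) ∧
        ¬ IsPadic p (∑ i, y i * (b i : ℝ))) := by
  have hp0 : (p : ℝ) ≠ 0 := by exact_mod_cast hp.ne_zero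
  refine (xor_iff_iff_not).2 ?_
  constructor
  · rintro ⟨x, hx, hAx⟩ ⟨y, hy, hyb⟩
    choose c hc using hy
    apply hyb
    have : ∑ i, y i * (b i : ℝ) = ∑ j, (c j : ℝ) * x j := by
      simp only [← hAx, ← hc, Finset.mul_sum, Finset.sum_mul]
      rw [Finset.sum_comm]
      simp only [mul_assoc]
    rw [this]
    exact isPadic_sum hp c x hx
  · intro hno
    let R : AddSubgroup (Fin m → ℤ) := (A.mulVecLin.range).toAddSubgroup
    have hR : ∀ v, v ∈ R ↔ ∃ x, A.mulVec x = v := fun v => Iff.rfl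
    have hq : ∀ q : ℕ, Nat.Coprime p q → ∃ k : ℤ, (1 - k * q) • b ∈ R := by
      intro q hpq
      by_contra hcon
      push Not at hcon
      have hbN : b ∉ R ⊔ AddSubgroup.zmultiples ((q : ℤ) • b) := by
        intro hb
        obtain ⟨u, hu, w, hw, huw⟩ := AddSubgroup.mem_sup.1 hb
        obtain ⟨k, rfl⟩ := AddSubgroup.mem_zmultiples_iff.1 hw
        apply hcon k
        have : (1 - k * q) • b = u := by
          rw [sub_smul, one_smul, mul_smul, sub_eq_iff_eq_add]; exact huw.symm
        rwa [this]
      obtain ⟨y, hy, hyb⟩ := separate _ b hbN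
      apply hno
      refine ⟨fun i => (y i : ℝ), fun j => ?_, ?_⟩
      · obtain ⟨c, hc⟩ := hy (fun i => A i j)
          (AddSubgroup.mem_sup_left ((hR _).2 ⟨Pi.single j 1, by ext i; simp⟩))
        exact ⟨c, by beta_reduce; exact_mod_cast hc⟩
      · rintro ⟨a, k, hk⟩
        obtain ⟨c, hc⟩ := hy ((q : ℤ) • b)
          (AddSubgroup.mem_sup_right (AddSubgroup.mem_zmultiples _))
        set s : ℚ := ∑ i, y i * (b i : ℚ) with hs
        have hc' : (q : ℚ) * s = c := by
          rw [← hc, hs, Finset.mul_sum]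
          refine Finset.sum_congr rfl fun i _ => ?_
          simp; ring
        have hk' : (p : ℚ) ^ k * s = a := by
          have : (p : ℝ) ^ k * (s : ℝ) = a := by
            rw [hs]; push_cast; rw [hk]; field_simp
          exact_mod_cast this
        have hcop : IsCoprime ((p : ℤ) ^ k) (q : ℤ) :=
          (Nat.isCoprime_iff_coprime.2 hpq).pow_left
        obtain ⟨α, β, hαβ⟩ := hcop
        have hαβ' : (α : ℚ) * (p : ℚ) ^ k + β * q = 1 := by exact_mod_cast hαβ
        apply hyb
        refine ⟨α * a + β * c, ?_⟩
        push_cast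
        rw [← hc', ← hk']
        linear_combination (-s) * hαβ'
    let I : Ideal ℤ := (A.mulVecLin.range).comap (LinearMap.toSpanSingleton ℤ _ b)
    have hI : ∀ c : ℤ, c ∈ I ↔ c • b ∈ R := fun c => Iff.rfl
    obtain ⟨d, hd⟩ := (IsPrincipalIdealRing.principal I).principal
    have hdiv : ∀ c : ℤ, c • b ∈ R ↔ d ∣ c := by
      intro c
      rw [← hI, hd]
      exact Ideal.mem_span_singleton
    have hd0 : d ≠ 0 := by
      rintro rfl
      obtain ⟨k, hk⟩ := hq (p + 1) (by simp)
      rw [hdiv, zero_dvd_iff] at hk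
      have h1 : ((p + 1 : ℕ) : ℤ) ∣ 1 := ⟨k, by linarith⟩
      have h2 := Int.le_of_dvd one_pos h1
      have := hp.two_le
      push_cast at h2
      omega
    obtain ⟨s, e, hpe, hde⟩ := Nat.exists_eq_pow_mul_and_not_dvd
      (n := d.natAbs) (by simpa using hd0) p hp.ne_one
    obtain ⟨k, hk⟩ := hq e ((Nat.Prime.coprime_iff_not_dvd hp).2 hpe)
    rw [hdiv] at hk
    have hed : (e : ℤ) ∣ d := by
      rw [Int.natCast_dvd, hde]
      exact Dvd.intro_left _ rfl
    have he1 : (e : ℤ) ∣ 1 := by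
      have h := dvd_add (hed.trans hk) (Dvd.intro_left k rfl : (e : ℤ) ∣ k * e)
      simpa using h
    have he : e = 1 := by
      have : e ∣ 1 := by exact_mod_cast he1
      exact Nat.dvd_one.1 this
    have hmem : ((p : ℤ) ^ s) • b ∈ R := by
      rw [hdiv, ← Int.natAbs_dvd, hde, he]
      simp
    obtain ⟨x, hx⟩ := (hR _).1 hmem
    refine ⟨fun j => (x j : ℝ) / (p : ℝ) ^ s, fun j => ⟨x j, s, rfl⟩, fun i => ?_⟩
    have h := congrFun hx i
    simp only [Matrix.mulVec, dotProduct, Pi.smul_apply, smul_eq_mul] at h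
    have h' : ∑ j, (A i j : ℝ) * (x j : ℝ) = (p : ℝ) ^ s * b i := by exact_mod_cast h
    simp only [← mul_div_assoc]
    rw [← Finset.sum_div, h']
    field_simp
end

section
/- Let A ∈ ℤ^{m×n} and b ∈ ℤ^m, and let p and q be distinct primes. If the system Ax = b has a p-adic solution and also has a q-adic solution, then it has an integral solution. -/
open Finset

lemma exists_int_scaled {m n : ℕ} (p : ℕ) (hp : p.Prime)
    (A : Matrix (Fin m) (Fin n) ℤ) (b : Fin m → ℤ)
    (hx : ∃ x : Fin n → ℝ, (∀ j, IsPadic p (x j)) ∧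
      ∀ i, ∑ j, (A i j : ℝ) * x j = (b i : ℝ)) :
    ∃ (K : ℕ) (z : Fin n → ℤ), ∀ i, ∑ j, A i j * z j = (p : ℤ) ^ K * b i := by
  obtain ⟨x, hx, hA⟩ := hx
  choose a k hak using hx
  have hp0 : (p : ℝ) ≠ 0 := by exact_mod_cast hp.ne_zero
  refine ⟨∑ j, k j, fun j => a j * (p : ℤ) ^ (∑ j, k j - k j), fun i => ?_⟩
  have key : ∀ j, ((a j * (p : ℤ) ^ (∑ j, k j - k j) : ℤ) : ℝ) = (p : ℝ) ^ (∑ j, k j) * x j := by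
    intro j
    have hle : k j ≤ ∑ j, k j :=
      Finset.single_le_sum (f := k) (fun _ _ => Nat.zero_le _) (Finset.mem_univ j)
    rw [hak j]
    push_cast
    rw [pow_sub₀ _ hp0 hle]
    field_simp
  have h : ((∑ j, A i j * (a j * (p : ℤ) ^ (∑ j, k j - k j)) : ℤ) : ℝ)
      = (((p : ℤ) ^ (∑ j, k j) * b i : ℤ) : ℝ) := by
    rw [Int.cast_sum, Int.cast_mul, ← hA i, Finset.mul_sum]
    refine Finset.sum_congr rfl fun j _ => ?_
    rw [Int.cast_mul, key j]
    push_cast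
    ring
  exact_mod_cast h

/-- If `Ax = b` (with `A, b` integral) has a `p`-adic solution and a
`q`-adic solution for distinct primes `p, q`, then it has an integral solution. -/
theorem p_and_q_adic_solution_implies_integral {m n : ℕ} (p q : ℕ)
    (hp : p.Prime) (hq : q.Prime) (hpq : p ≠ q)
    (A : Matrix (Fin m) (Fin n) ℤ) (b : Fin m → ℤ)
    (hx : ∃ x : Fin n → ℝ, (∀ j, IsPadic p (x j)) ∧
      ∀ i, ∑ j, (A i j : ℝ) * x j = (b i : ℝ))
    (hy : ∃ x : Fin n → ℝ, (∀ j, IsPadic q (x j)) ∧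
      ∀ i, ∑ j, (A i j : ℝ) * x j = (b i : ℝ)) :
    ∃ x : Fin n → ℤ, ∀ i, ∑ j, A i j * x j = b i := by
  obtain ⟨K, z, hz⟩ := exists_int_scaled p hp A b hx
  obtain ⟨L, w, hw⟩ := exists_int_scaled q hq A b hy
  have hc : IsCoprime ((p : ℤ) ^ K) ((q : ℤ) ^ L) :=
    (Nat.isCoprime_iff_coprime.mpr ((Nat.coprime_primes hp hq).mpr hpq)).pow
  obtain ⟨u, v, huv⟩ := hc
  refine ⟨fun j => u * z j + v * w j, fun i => ?_⟩
  calc ∑ j, A i j * (u * z j + v * w j)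
      = u * ∑ j, A i j * z j + v * ∑ j, A i j * w j := by
        rw [Finset.mul_sum, Finset.mul_sum, ← Finset.sum_add_distrib]
        exact Finset.sum_congr rfl fun j _ => by ring
    _ = (u * (p : ℤ) ^ K + v * (q : ℤ) ^ L) * b i := by rw [hz i, hw i]; ring
    _ = b i := by rw [huv, one_mul]
end

section
/- Let p be a prime and let P be a nonempty rational polyhedron whose affine hull equals {x : Ax = b}, where A ∈ ℤ^{m×n} and b ∈ ℤ^m. Then P contains a p-adic point if, and only if, there does not exist y ∈ ℝ^m such that yᵀA is an integral vector and yᵀb is not a p-adic rational. -/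
open Finset

lemma padic_int (p : ℕ) (a : ℤ) : IsPadic p a := ⟨a, 0, by simp⟩

lemma padic_add (p : ℕ) (hp : p.Prime) {x y : ℝ} (hx : IsPadic p x) (hy : IsPadic p y) :
    IsPadic p (x + y) := by
  obtain ⟨a, k, rfl⟩ := hx
  obtain ⟨c, l, rfl⟩ := hy
  have : (p : ℝ) ≠ 0 := by exact_mod_cast hp.ne_zero
  refine ⟨a * p ^ l + c * p ^ k, k + l, ?_⟩
  push_cast
  rw [pow_add]
  field_simp

lemma padic_mul (p : ℕ) (hp : p.Prime) {x y : ℝ} (hx : IsPadic p x) (hy : IsPadic p y) :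
    IsPadic p (x * y) := by
  obtain ⟨a, k, rfl⟩ := hx
  obtain ⟨c, l, rfl⟩ := hy
  have : (p : ℝ) ≠ 0 := by exact_mod_cast hp.ne_zero
  refine ⟨a * c, k + l, ?_⟩
  push_cast
  rw [pow_add]
  field_simp

lemma padic_sum (p : ℕ) (hp : p.Prime) {ι : Type*} (s : Finset ι) (f : ι → ℝ)
    (h : ∀ i ∈ s, IsPadic p (f i)) : IsPadic p (∑ i ∈ s, f i) :=
  Finset.sum_induction f (IsPadic p) (fun _ _ => padic_add p hp)
    (by simpa using padic_int p 0) h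

lemma padic_dense (p : ℕ) (hp : p.Prime) : Dense {r : ℝ | IsPadic p r} := by
  refine dense_of_exists_between ?_
  intro a c hac
  have hp1 : (1 : ℝ) < p := by exact_mod_cast hp.one_lt
  obtain ⟨k, hk⟩ := pow_unbounded_of_one_lt (1 / (c - a)) hp1
  have hpos : (0 : ℝ) < (p : ℝ) ^ k := by positivity
  have hca : 0 < c - a := by linarith
  rw [div_lt_iff₀ hca] at hk
  refine ⟨((⌊a * p ^ k⌋ + 1 : ℤ) : ℝ) / p ^ k, ⟨_, k, rfl⟩, ?_, ?_⟩
  · rw [lt_div_iff₀ hpos]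
    push_cast
    exact Int.lt_floor_add_one _
  · rw [div_lt_iff₀ hpos]
    push_cast
    have := Int.floor_le (a * p ^ k)
    nlinarith

lemma exists_not_mem_span (p : ℕ) (hp : p.Prime) {M : Type*} [AddCommGroup M] (b : M)
    (h : ∀ q : ℕ, q.Prime → q ≠ p → ∃ k : ℤ, k • ((q : ℤ) • b) = b) :
    ∃ k : ℕ, ((p : ℤ) ^ k) • b = 0 := by
  have key : ∀ q : ℕ, q.Prime → q ≠ p → ¬ q ∣ addOrderOf b := by
    intro q hq hqp hd
    obtain ⟨k, hk⟩ := h q hq hqp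
    have h1 : (1 - k * q : ℤ) • b = 0 := by
      rw [sub_smul, mul_smul, hk]; simp
    rw [← addOrderOf_dvd_iff_zsmul_eq_zero] at h1
    have h2 : (q : ℤ) ∣ 1 - k * q := (Int.natCast_dvd_natCast.mpr hd).trans h1
    have h3 : (q : ℤ) ∣ 1 := by
      have := dvd_add h2 (Dvd.intro_left k rfl)
      simpa using this
    have h4 : q ∣ 1 := by exact_mod_cast h3
    exact hq.one_lt.ne' (Nat.dvd_one.mp h4)
  have hne : addOrderOf b ≠ 0 := by
    intro h0
    obtain ⟨q, hq, hqq⟩ := Nat.exists_infinite_primes (p + 1)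
    exact key q hqq (by omega) (by simp [h0])
  have := Nat.eq_prime_pow_of_unique_prime_dvd (p := p) hne (by
    intro q hq hd
    by_contra hqp
    exact key q hq hqp hd)
  refine ⟨(addOrderOf b).primeFactorsList.length, addOrderOf_dvd_iff_zsmul_eq_zero.mp ?_⟩
  exact_mod_cast this.dvd

lemma coprime_trick (p q : ℕ) (hp : p.Prime) (hq : q.Prime) (hqp : q ≠ p) (r : ℝ)
    (hr : IsPadic p r) (c : ℤ) (hc : q * r = c) : ∃ d : ℤ, r = d := by
  obtain ⟨a, k, rfl⟩ := hr
  have h0 : (p : ℝ) ≠ 0 := by exact_mod_cast hp.ne_zero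
  have h1 : (q : ℤ) * a = p ^ k * c := by
    have : (q : ℝ) * a = p ^ k * c := by
      rw [← hc]; field_simp
    exact_mod_cast this
  have hcop : IsCoprime ((p : ℤ) ^ k) (q : ℤ) := by
    apply IsCoprime.pow_left
    rw [Nat.isCoprime_iff_coprime]
    exact (Nat.coprime_primes hp hq).mpr (Ne.symm hqp)
  obtain ⟨d, hd⟩ := hcop.dvd_of_dvd_mul_left (Dvd.intro c h1.symm)
  refine ⟨d, ?_⟩
  rw [hd]; push_cast; field_simp

lemma exists_char {m : ℕ} (S : AddSubgroup (Fin m → ℤ)) (b : Fin m → ℤ) (hb : b ∉ S) :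
    ∃ y : Fin m → ℚ, (∀ v ∈ S, ∃ c : ℤ, ∑ i, y i * (v i : ℚ) = c) ∧
      ¬ ∃ c : ℤ, ∑ i, y i * (b i : ℚ) = c := by
  have hne : (QuotientAddGroup.mk b : (Fin m → ℤ) ⧸ S) ≠ 0 := by
    rwa [Ne, QuotientAddGroup.eq_zero_iff]
  obtain ⟨χ, hχ⟩ := CharacterModule.exists_character_apply_ne_zero_of_ne_zero hne
  have hy : ∀ i, ∃ t : ℚ, (QuotientAddGroup.mk t : AddCircle (1 : ℚ)) =
      χ (QuotientAddGroup.mk (Pi.single i 1)) := fun i => QuotientAddGroup.mk_surjective _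
  choose y hy using hy
  have key : ∀ v : Fin m → ℤ, ((∑ i, y i * (v i : ℚ) : ℚ) : AddCircle (1 : ℚ)) =
      χ (QuotientAddGroup.mk v) := by
    intro v
    have hv : v = ∑ i, v i • (Pi.single i 1 : Fin m → ℤ) := by
      ext j; simp [Finset.sum_apply, Pi.single_apply]
    conv_rhs => rw [hv]
    have : (QuotientAddGroup.mk (∑ i, v i • (Pi.single i 1 : Fin m → ℤ)) : (Fin m → ℤ) ⧸ S)
      = ∑ i, v i • (QuotientAddGroup.mk (Pi.single i 1 : Fin m → ℤ) : (Fin m → ℤ) ⧸ S) := by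
      change QuotientAddGroup.mk' S _ = _
      rw [map_sum]; rfl
    rw [this, map_sum]
    have h2 : ((∑ i, y i * (v i : ℚ) : ℚ) : AddCircle (1 : ℚ)) =
      ∑ i, ((y i * (v i : ℚ) : ℚ) : AddCircle (1 : ℚ)) := by
      change QuotientAddGroup.mk' _ _ = _
      rw [map_sum]; rfl
    rw [h2]
    refine Finset.sum_congr rfl fun i _ => ?_
    rw [map_zsmul, ← hy i, mul_comm, ← zsmul_eq_mul]
    rfl
  have hz : ∀ r : ℚ, (r : AddCircle (1 : ℚ)) = 0 ↔ ∃ c : ℤ, r = c := by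
    intro r
    rw [AddCircle.coe_eq_zero_iff]
    constructor
    · rintro ⟨c, hc⟩; exact ⟨c, by simpa using hc.symm⟩
    · rintro ⟨c, hc⟩; exact ⟨c, by simpa using hc.symm⟩
  refine ⟨y, fun v hv => ?_, fun h => ?_⟩
  · rw [← hz, key, (QuotientAddGroup.eq_zero_iff v).mpr hv]; exact map_zero χ
  · rw [← hz, key] at h; exact hχ h

lemma padic_solution {m n : ℕ} (p : ℕ) (hp : p.Prime)
    (A : Matrix (Fin m) (Fin n) ℤ) (b : Fin m → ℤ)
    (h : ¬ ∃ y : Fin m → ℝ, (∀ j, ∃ c : ℤ, ∑ i, y i * (A i j : ℝ) = (c : ℝ)) ∧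
        ¬ IsPadic p (∑ i, y i * (b i : ℝ))) :
    ∃ x : Fin n → ℝ, (∀ j, IsPadic p (x j)) ∧ ∀ i, ∑ j, (A i j : ℝ) * x j = b i := by
  let T : AddSubgroup (Fin m → ℤ) := (A.mulVecLin).range.toAddSubgroup
  have hT : ∃ k : ℕ, ((p : ℤ) ^ k) • (QuotientAddGroup.mk b : (Fin m → ℤ) ⧸ T) = 0 := by
    apply exists_not_mem_span p hp
    intro q hq hqp
    by_contra hcon
    let S : AddSubgroup (Fin m → ℤ) := T ⊔ AddSubgroup.zmultiples ((q : ℤ) • b)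
    have hbS : b ∉ S := by
      intro hb
      obtain ⟨t, ht, u, hu, htu⟩ := AddSubgroup.mem_sup.mp hb
      obtain ⟨k, hk⟩ := AddSubgroup.mem_zmultiples_iff.mp hu
      apply hcon
      refine ⟨k, ?_⟩
      change (QuotientAddGroup.mk (k • ((q : ℤ) • b)) : (Fin m → ℤ) ⧸ T) = _
      rw [QuotientAddGroup.eq, hk]
      have : -u + b = t := by rw [← htu]; abel
      rwa [this]
    obtain ⟨y, hy, hyb⟩ := exists_char S b hbS
    apply h
    refine ⟨fun i => (y i : ℝ), fun j => ?_, fun hpad => ?_⟩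
    · obtain ⟨c, hc⟩ := hy (fun i => A i j) (AddSubgroup.mem_sup_left (by
        refine ⟨Pi.single j 1, ?_⟩
        ext i; simp))
      exact ⟨c, by beta_reduce; exact_mod_cast congrArg (fun r : ℚ => (r : ℝ)) hc⟩
    · obtain ⟨c, hc⟩ := hy ((q : ℤ) • b) (AddSubgroup.mem_sup_right
        (AddSubgroup.mem_zmultiples _))
      obtain ⟨d, hd⟩ := coprime_trick p q hp hq hqp _ hpad c (by
        have h1 : (q : ℚ) * ∑ i, y i * (b i : ℚ) = c := by
          rw [← hc, Finset.mul_sum]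
          refine Finset.sum_congr rfl fun i _ => ?_
          simp; ring
        beta_reduce
        exact_mod_cast congrArg (fun r : ℚ => (r : ℝ)) h1)
      beta_reduce at hd
      exact hyb ⟨d, by exact_mod_cast hd⟩
  obtain ⟨k, hk⟩ := hT
  change (QuotientAddGroup.mk (((p : ℤ) ^ k) • b) : (Fin m → ℤ) ⧸ T) = 0 at hk
  rw [QuotientAddGroup.eq_zero_iff] at hk
  obtain ⟨z, hz⟩ := hk
  refine ⟨fun j => (z j : ℝ) / p ^ k, fun j => ⟨z j, k, rfl⟩, fun i => ?_⟩
  have h1 : ∑ j, A i j * z j = (p : ℤ) ^ k * b i := by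
    have := congrFun hz i
    simpa [Matrix.mulVec, dotProduct] using this
  have h2 : ∑ j, (A i j : ℝ) * z j = (p : ℝ) ^ k * b i := by exact_mod_cast h1
  have h0 : (p : ℝ) ≠ 0 := by exact_mod_cast hp.ne_zero
  simp_rw [← mul_div_assoc]
  rw [← Finset.sum_div, h2]
  field_simp

lemma kernel_span {m n : ℕ} (A : Matrix (Fin m) (Fin n) ℤ) (w : Fin n → ℝ)
    (hw : ∀ i, ∑ j, (A i j : ℝ) * w j = 0) :
    ∃ (r : ℕ) (t : Fin r → ℝ) (u : Fin r → Fin n → ℤ),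
      (∀ k i, ∑ j, A i j * u k j = 0) ∧ ∀ j, w j = ∑ k, t k * (u k j : ℝ) := by
  let V : Submodule ℚ ℝ := Submodule.span ℚ (Set.range w)
  have : FiniteDimensional ℚ V := FiniteDimensional.span_of_finite ℚ (Set.finite_range w)
  let β := Module.finBasis ℚ V
  let W : Fin n → V := fun j => ⟨w j, Submodule.subset_span ⟨j, rfl⟩⟩
  have hW : ∀ i, ∑ j, (A i j : ℚ) • W j = 0 := by
    intro i
    apply Subtype.ext
    have := hw i
    simpa [W, Rat.smul_def] using this
  let c : Fin (Module.finrank ℚ V) → Fin n → ℚ := fun k j => β.repr (W j) k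
  have hc : ∀ k i, ∑ j, (A i j : ℚ) * c k j = 0 := by
    intro k i
    have := congrArg (fun v => β.repr v k) (hW i)
    simpa [c, Finsupp.finsetSum_apply] using this
  have hwc : ∀ j, w j = ∑ k, (β k : ℝ) * (c k j : ℝ) := by
    intro j
    have := congrArg (fun v : V => (v : ℝ)) (β.sum_repr (W j))
    simp only [Submodule.coe_sum, Submodule.coe_smul, Rat.smul_def] at this
    rw [show w j = (W j : ℝ) from rfl, ← this]
    exact Finset.sum_congr rfl fun k _ => mul_comm _ _
  -- a common denominator
  let D : ℕ := ∏ k, ∏ j, (c k j).den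
  have hD : (D : ℚ) ≠ 0 := by
    have : D ≠ 0 := Finset.prod_ne_zero_iff.mpr fun k _ =>
      Finset.prod_ne_zero_iff.mpr fun j _ => (c k j).den_ne_zero
    exact_mod_cast this
  have hint : ∀ k j, ∃ a : ℤ, (a : ℚ) = D * c k j := by
    intro k j
    have hd : (c k j).den ∣ D :=
      (Finset.dvd_prod_of_mem (fun j => (c k j).den) (Finset.mem_univ j)).trans
        (Finset.dvd_prod_of_mem (fun k => ∏ j, (c k j).den) (Finset.mem_univ k))
    obtain ⟨e, he⟩ := hd
    refine ⟨e * (c k j).num, ?_⟩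
    rw [he]
    push_cast
    have := Rat.mul_den_eq_num (c k j)
    rw [← this]; ring
  choose u hu using hint
  refine ⟨_, fun k => (β k : ℝ) / D, u, fun k i => ?_, fun j => ?_⟩
  · have : ∑ j, (A i j : ℚ) * (u k j : ℚ) = 0 := by
      simp_rw [hu, mul_left_comm _ (D : ℚ)]
      rw [← Finset.mul_sum, hc, mul_zero]
    exact_mod_cast this
  · rw [hwc]
    refine Finset.sum_congr rfl fun k _ => ?_
    have h1 : ((u k j : ℤ) : ℝ) = D * (c k j : ℝ) := by exact_mod_cast congrArg (fun r : ℚ => (r : ℝ)) (hu k j)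
    have h2 : (D : ℝ) ≠ 0 := by exact_mod_cast hD
    rw [h1]; field_simp

lemma padic_near {m n : ℕ} (p : ℕ) (hp : p.Prime)
    (A : Matrix (Fin m) (Fin n) ℤ) (b : Fin m → ℤ) (x : Fin n → ℝ)
    (hx : ∀ j, IsPadic p (x j)) (hxb : ∀ i, ∑ j, (A i j : ℝ) * x j = b i)
    (z : Fin n → ℝ) (hz : ∀ i, ∑ j, (A i j : ℝ) * z j = b i)
    (U : Set (Fin n → ℝ)) (hU : IsOpen U) (hzU : z ∈ U) :
    ∃ x' ∈ U, (∀ j, IsPadic p (x' j)) ∧ ∀ i, ∑ j, (A i j : ℝ) * x' j = b i := by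
  obtain ⟨r, t, u, hu, ht⟩ := kernel_span A (fun j => z j - x j) (by
    intro i
    simp [mul_sub, hxb, hz])
  let f : (Fin r → ℝ) → (Fin n → ℝ) := fun s j => x j + ∑ k, s k * (u k j : ℝ)
  have hf : Continuous f := by fun_prop
  have hft : f t = z := by
    ext j
    simp [f, ← ht]
  have hd : Dense (Set.pi Set.univ fun _ : Fin r => {r : ℝ | IsPadic p r}) :=
    dense_pi Set.univ fun _ _ => padic_dense p hp
  obtain ⟨s, hsU, hs⟩ := hd.exists_mem_open (hU.preimage hf) ⟨t, by simpa [hft] using hzU⟩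
  refine ⟨f s, ‹_›, fun j => ?_, fun i => ?_⟩
  · exact padic_add p hp (hx j) (padic_sum p hp _ _ fun k _ =>
      padic_mul p hp (hsU k trivial) (padic_int p _))
  · simp only [f, mul_add, Finset.sum_add_distrib, hxb, Finset.mul_sum]
    rw [Finset.sum_comm]
    rw [Finset.sum_eq_zero, add_zero]
    intro k _
    have h1 : ∑ j, (A i j : ℝ) * (u k j : ℝ) = 0 := by exact_mod_cast hu k i
    simp_rw [mul_left_comm _ (s k)]
    rw [← Finset.mul_sum, h1, mul_zero]

/-- **`p`-adic Farkas Lemma.** Let `P = {x : A'x ≤ b'}` be a nonempty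
rational polyhedron whose affine hull is `{x : Ax = b}` with `A, b` integral. Then `P`
contains a `p`-adic point iff there is no `y` with `yᵀA` integral and `yᵀb` not `p`-adic. -/
theorem padic_farkas_lemma {m m' n : ℕ} (p : ℕ) (hp : p.Prime)
    (A : Matrix (Fin m) (Fin n) ℤ) (b : Fin m → ℤ)
    (A' : Matrix (Fin m') (Fin n) ℚ) (b' : Fin m' → ℚ)
    (hPne : {x : Fin n → ℝ | ∀ i, ∑ j, (A' i j : ℝ) * x j ≤ (b' i : ℝ)}.Nonempty)
    (haff : (affineSpan ℝ
        {x : Fin n → ℝ | ∀ i, ∑ j, (A' i j : ℝ) * x j ≤ (b' i : ℝ)} :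
          Set (Fin n → ℝ)) =
      {x : Fin n → ℝ | ∀ i, ∑ j, (A i j : ℝ) * x j = (b i : ℝ)}) :
    (∃ x ∈ {x : Fin n → ℝ | ∀ i, ∑ j, (A' i j : ℝ) * x j ≤ (b' i : ℝ)},
      ∀ j, IsPadic p (x j)) ↔
    ¬ ∃ y : Fin m → ℝ, (∀ j, ∃ c : ℤ, ∑ i, y i * (A i j : ℝ) = (c : ℝ)) ∧
        ¬ IsPadic p (∑ i, y i * (b i : ℝ)) := by
  set P : Set (Fin n → ℝ) := {x | ∀ i, ∑ j, (A' i j : ℝ) * x j ≤ (b' i : ℝ)} with hP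
  constructor
  · rintro ⟨x, hxP, hx⟩ ⟨y, hy, hyb⟩
    apply hyb
    have hxA : x ∈ (affineSpan ℝ P : Set (Fin n → ℝ)) := subset_affineSpan ℝ P hxP
    rw [haff] at hxA
    choose c hc using hy
    have : ∑ i, y i * (b i : ℝ) = ∑ j, (c j : ℝ) * x j := by
      simp_rw [← hc, Finset.sum_mul]
      rw [Finset.sum_comm]
      refine Finset.sum_congr rfl fun i _ => ?_
      rw [← hxA i, Finset.mul_sum]
      exact Finset.sum_congr rfl fun j _ => (mul_assoc _ _ _).symm
    rw [this]
    exact padic_sum p hp _ _ fun j _ => padic_mul p hp (padic_int p _) (hx j)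
  · intro h
    obtain ⟨x, hx, hxb⟩ := padic_solution p hp A b h
    have hconv : Convex ℝ P := by
      intro v hv w hw s t hs ht hst i
      have h1 := mul_le_mul_of_nonneg_left (hv i) hs
      have h2 := mul_le_mul_of_nonneg_left (hw i) ht
      have h3 : ∑ j, (A' i j : ℝ) * (s • v + t • w) j =
          s * ∑ j, (A' i j : ℝ) * v j + t * ∑ j, (A' i j : ℝ) * w j := by
        rw [Finset.mul_sum, Finset.mul_sum, ← Finset.sum_add_distrib]
        refine Finset.sum_congr rfl fun j _ => ?_
        simp; ring
      have h4 : s * (b' i : ℝ) + t * (b' i : ℝ) = b' i := by rw [← add_mul, hst, one_mul]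
      rw [h3]; linarith
    obtain ⟨z, hz⟩ := hPne.intrinsicInterior hconv
    obtain ⟨z', hz', rfl⟩ := mem_intrinsicInterior.mp hz
    obtain ⟨O, hOP, hO, hzO⟩ := mem_interior.mp hz'
    obtain ⟨U, hU, rfl⟩ := isOpen_induced_iff.mp hO
    have hzA : (z' : Fin n → ℝ) ∈ (affineSpan ℝ P : Set (Fin n → ℝ)) := z'.2
    rw [haff] at hzA
    obtain ⟨x', hx'U, hx'p, hx'b⟩ := padic_near p hp A b x hx hxb z' hzA U hU hzO
    have hx'A : x' ∈ (affineSpan ℝ P : Set (Fin n → ℝ)) := by rw [haff]; exact hx'b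
    exact ⟨x', hOP (a := ⟨x', hx'A⟩) hx'U, hx'p⟩
end

section
/- Let p be a prime. If {a¹,…,aⁿ} ⊆ ℤ^m is a p-adic generating set for a cone, then it is a p-adic generating set for a subspace. -/
open Finset

attribute [local instance] Classical.propDecidable

/-- A finite family of integral vectors is a `p`-adic generating set for a cone if every
integral vector in its conic hull is a conic combination of the vectors with `p`-adic
coefficients. -/
def IsPGSC (p : ℕ) {ι d : Type} [Fintype ι] [Fintype d] (a : ι → d → ℤ) : Prop :=
  ∀ w : d → ℤ,
    (∃ lam : ι → ℝ, (∀ i, 0 ≤ lam i) ∧ ∀ j, ∑ i, lam i * (a i j : ℝ) = (w j : ℝ)) →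
    ∃ lam : ι → ℝ, (∀ i, 0 ≤ lam i) ∧ (∀ i, IsPadic p (lam i)) ∧
      ∀ j, ∑ i, lam i * (a i j : ℝ) = (w j : ℝ)

/-- A finite family of integral vectors is a `p`-adic generating set for a subspace if every
integral vector in its linear hull is a linear combination of the vectors with `p`-adic
coefficients. -/
def IsPGSS (p : ℕ) {ι d : Type} [Fintype ι] [Fintype d] (a : ι → d → ℤ) : Prop :=
  ∀ w : d → ℤ,
    (∃ lam : ι → ℝ, ∀ j, ∑ i, lam i * (a i j : ℝ) = (w j : ℝ)) →
    ∃ lam : ι → ℝ, (∀ i, IsPadic p (lam i)) ∧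
      ∀ j, ∑ i, lam i * (a i j : ℝ) = (w j : ℝ)

/-- `F` is a face of `P`: the intersection of `P` with a supporting hyperplane (this includes
`P` itself, via `c = 0, δ = 0`). -/
def IsFace {d : Type} [Fintype d] (P F : Set (d → ℝ)) : Prop :=
  ∃ (c : d → ℝ) (δ : ℝ), (∀ x ∈ P, ∑ j, c j * x j ≤ δ) ∧
    F = {x ∈ P | ∑ j, c j * x j = δ}

/-- `y` is feasible for the dual LP `min {bᵀy : Aᵀy = w, y ≥ 0}`. -/
def DualFeasible {m n : ℕ} (A : Matrix (Fin m) (Fin n) ℤ) (w : Fin n → ℤ)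
    (y : Fin m → ℝ) : Prop :=
  (∀ i, 0 ≤ y i) ∧ ∀ j, ∑ i, y i * (A i j : ℝ) = (w j : ℝ)

/-- `y` is an optimal solution of the dual LP `min {bᵀy : Aᵀy = w, y ≥ 0}`. -/
def DualOptimal {m n : ℕ} (A : Matrix (Fin m) (Fin n) ℤ) (b : Fin m → ℤ) (w : Fin n → ℤ)
    (y : Fin m → ℝ) : Prop :=
  DualFeasible A w y ∧
    ∀ y', DualFeasible A w y' → ∑ i, (b i : ℝ) * y i ≤ ∑ i, (b i : ℝ) * y' i

/-- The system `Ax ≤ b` is totally dual `p`-adic. -/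
def TotallyDualPadic (p : ℕ) {m n : ℕ} (A : Matrix (Fin m) (Fin n) ℤ) (b : Fin m → ℤ) : Prop :=
  ∀ w : Fin n → ℤ, (∃ y, DualOptimal A b w y) →
    ∃ y, DualOptimal A b w y ∧ ∀ i, IsPadic p (y i)

/-- Every `p`-adic generating set for a cone is a `p`-adic generating set
for a subspace. -/
theorem pGSC_implies_pGSS {m n : ℕ} (p : ℕ) (hp : p.Prime) (a : Fin n → Fin m → ℤ)
    (h : IsPGSC p a) : IsPGSS p a := by
  rintro w ⟨lam, hlam⟩
  obtain ⟨mu, _, hmu, hs⟩ := h (fun j => w j + ∑ i, ⌈|lam i|⌉ * a i j)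
    ⟨fun i => lam i + (⌈|lam i|⌉ : ℤ), fun i => by
        have h1 := Int.le_ceil |lam i|
        have h2 := neg_abs_le (lam i)
        linarith, fun j => by
        push_cast
        rw [← hlam j, ← Finset.sum_add_distrib]
        exact Finset.sum_congr rfl fun i _ => by ring⟩
  refine ⟨fun i => mu i - (⌈|lam i|⌉ : ℤ), fun i => ?_, fun j => ?_⟩
  · obtain ⟨b, k, hb⟩ := hmu i
    refine ⟨b - ⌈|lam i|⌉ * (p : ℤ) ^ k, k, ?_⟩
    have hp0 : (p : ℝ) ^ k ≠ 0 := pow_ne_zero _ (Nat.cast_ne_zero.mpr hp.ne_zero)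
    simp only [hb]
    push_cast
    rw [sub_div, mul_div_cancel_right₀ _ hp0]
  · have h3 := hs j
    push_cast at h3
    simp only [sub_mul, Finset.sum_sub_distrib]
    linarith
end

section
/- Let p be a prime, let {a¹,…,aⁿ} ⊆ ℤ^m be a p-adic generating set for a cone, and let F be a nonempty face of the cone C := cone{a¹,…,aⁿ}. Then {aⁱ : aⁱ ∈ F} is a p-adic generating set for the cone F; that is, every integral vector in F can be written as a conic combination of the vectors in {aⁱ : aⁱ ∈ F} with p-adic coefficients. -/
open Finset

attribute [local instance] Classical.propDecidable

/-- If `{a¹, …, aⁿ} ⊆ ℤ^m` is a `p`-adic generating set for a cone and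
`F` is a nonempty face of `C = cone{a¹, …, aⁿ}`, then the vectors among `a¹, …, aⁿ` lying
on `F` form a `p`-adic generating set for the cone `F`: every integral vector in `F` is a
conic combination of them with `p`-adic coefficients. -/
theorem pGSC_restricts_to_faces {m n : ℕ} (p : ℕ) (hp : p.Prime)
    (a : Fin n → Fin m → ℤ) (hGSC : IsPGSC p a)
    (F : Set (Fin m → ℝ))
    (hF : IsFace {x | ∃ lam : Fin n → ℝ, (∀ i, 0 ≤ lam i) ∧
      ∀ j, x j = ∑ i, lam i * (a i j : ℝ)} F)
    (hFne : F.Nonempty) :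
    ∀ w : Fin m → ℤ, (fun j => (w j : ℝ)) ∈ F →
      ∃ lam : {i : Fin n // (fun j => (a i j : ℝ)) ∈ F} → ℝ,
        (∀ i, 0 ≤ lam i) ∧ (∀ i, IsPadic p (lam i)) ∧
        ∀ j, ∑ i, lam i * (a i.1 j : ℝ) = (w j : ℝ) := by
  intro w hw
  obtain ⟨c, δ, hle, rfl⟩ := hF
  obtain ⟨⟨l0, hl0, hl0w⟩, hwδ⟩ := hw
  obtain ⟨lam, hpos, hpad, hsum⟩ := hGSC w ⟨l0, hl0, fun j => (hl0w j).symm⟩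
  have h0 : 0 ≤ δ := by
    have := hle (fun _ => 0) ⟨fun _ => 0, fun _ => le_rfl, fun j => by simp⟩
    simpa using this
  have h2 : δ ≤ 0 := by
    have := hle (fun j => 2 * (w j : ℝ)) ⟨fun i => 2 * lam i,
      fun i => mul_nonneg zero_le_two (hpos i), fun j => by
        beta_reduce
        rw [← hsum j, Finset.mul_sum]
        exact Finset.sum_congr rfl fun i _ => by ring⟩
    have h3 : ∑ j, c j * (2 * (w j : ℝ)) = 2 * ∑ j, c j * (w j : ℝ) := by
      rw [Finset.mul_sum]
      exact Finset.sum_congr rfl fun i _ => by ring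
    have h4 : ∑ j, c j * (w j : ℝ) = δ := hwδ
    have h5 : ∑ j, c j * (2 * (w j : ℝ)) ≤ δ := this
    linarith
  have hδ : δ = 0 := le_antisymm h2 h0
  subst hδ
  have hmem : ∀ i, (fun j => (a i j : ℝ)) ∈ {x : Fin m → ℝ | ∃ lam : Fin n → ℝ,
      (∀ i, 0 ≤ lam i) ∧ ∀ j, x j = ∑ i, lam i * (a i j : ℝ)} := fun i =>
    ⟨fun k => if k = i then 1 else 0, fun k => by dsimp only; split_ifs <;> norm_num,
      fun j => by simp⟩
  have hai : ∀ i, ∑ j, c j * (a i j : ℝ) ≤ 0 := fun i => hle _ (hmem i)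
  have hcw : ∑ i, lam i * ∑ j, c j * (a i j : ℝ) = 0 := by
    have h4 : ∑ j, c j * (w j : ℝ) = 0 := hwδ
    rw [← h4]
    simp_rw [← hsum, Finset.mul_sum]
    rw [Finset.sum_comm]
    exact Finset.sum_congr rfl fun i _ => Finset.sum_congr rfl fun j _ => by ring
  have hz := (Finset.sum_eq_zero_iff_of_nonpos
    (fun i _ => mul_nonpos_of_nonneg_of_nonpos (hpos i) (hai i))).1 hcw
  refine ⟨fun i => lam i.1, fun i => hpos _, fun i => hpad _, fun j => ?_⟩
  rw [← hsum j]
  refine Finset.sum_of_injOn (fun i => i.1) (fun x _ y _ h => Subtype.ext h)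
    (fun _ _ => Finset.mem_coe.2 (Finset.mem_univ _)) ?_ (fun _ _ => rfl)
  intro i _ hi
  rcases mul_eq_zero.1 (hz i (Finset.mem_univ _)) with h | h
  · rw [h, zero_mul]
  · exact absurd ⟨⟨i, hmem i, h⟩, Finset.mem_coe.2 (@Finset.mem_univ _ (_) _), rfl⟩ hi
end

section
/- Let p be a prime, A ∈ ℤ^{m×n}, and b ∈ ℤ^m. If the system Ax ≤ b is totally dual p-adic, then {x : Ax ≤ b} is a p-adic polyhedron, i.e., every nonempty face of {x : Ax ≤ b} contains a p-adic point. -/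
open Finset

attribute [local instance] Classical.propDecidable

lemma exists_rat_functional {ι : Type} [Fintype ι] (S : AddSubgroup (ι → ℤ)) (v : ι → ℤ)
    (hv : v ∉ S) : ∃ y : ι → ℚ, (∀ s ∈ S, ∃ z : ℤ, ∑ i, y i * (s i : ℚ) = z) ∧
      ¬ ∃ z : ℤ, ∑ i, y i * (v i : ℚ) = z := by
  have hne : (QuotientAddGroup.mk v : (ι → ℤ) ⧸ S) ≠ 0 := by
    rwa [Ne, QuotientAddGroup.eq_zero_iff]
  obtain ⟨χ, hχ⟩ := CharacterModule.exists_character_apply_ne_zero_of_ne_zero hne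
  let f : (ι → ℤ) →+ AddCircle (1 : ℚ) :=
    AddMonoidHom.comp (χ : ((ι → ℤ) ⧸ S) →+ AddCircle (1 : ℚ)) (QuotientAddGroup.mk' S)
  have hsurj : ∀ i : ι, ∃ y : ℚ, (y : AddCircle (1 : ℚ)) = f (Pi.single i 1) := fun i =>
    QuotientAddGroup.mk_surjective _
  choose y hy using hsurj
  have key : ∀ s : ι → ℤ, ((∑ i, y i * (s i : ℚ) : ℚ) : AddCircle (1 : ℚ)) = f s := by
    intro s
    have hs : s = ∑ i, s i • (Pi.single i (1 : ℤ) : ι → ℤ) := by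
      funext j
      simp [Finset.sum_apply, Pi.single_apply]
    have e1 : ((∑ i, y i * (s i : ℚ) : ℚ) : AddCircle (1 : ℚ))
        = ∑ i, s i • ((y i : ℚ) : AddCircle (1 : ℚ)) := by
      have : ∀ i, y i * (s i : ℚ) = s i • y i := fun i => by
        rw [zsmul_eq_mul, mul_comm]
      simp only [this]
      exact map_sum (QuotientAddGroup.mk' (AddSubgroup.zmultiples (1 : ℚ)))
        (fun i => s i • y i) Finset.univ
    rw [e1]
    conv_rhs => rw [hs, map_sum]
    refine Finset.sum_congr rfl fun i _ => ?_
    rw [map_zsmul, hy]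
  have zero_iff : ∀ q : ℚ, ((q : AddCircle (1 : ℚ)) = 0) ↔ ∃ z : ℤ, q = z := by
    intro q
    rw [AddCircle.coe_eq_zero_iff]
    simp [eq_comm]
  refine ⟨y, fun s hs => ?_, fun hz => ?_⟩
  · rw [← zero_iff, key]
    have : (QuotientAddGroup.mk' S) s = 0 := by
      rw [QuotientAddGroup.mk'_apply, QuotientAddGroup.eq_zero_iff]; exact hs
    show χ ((QuotientAddGroup.mk' S) s) = 0
    rw [this]; exact map_zero χ
  · rw [← zero_iff, key] at hz
    exact hχ hz

lemma exists_scaled_solution {ι : Type} [Fintype ι] {n p : ℕ} (hp : p.Prime)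
    (M : ι → Fin n → ℤ) (b : ι → ℤ)
    (H : ∀ y : ι → ℚ, (∀ j, ∃ z : ℤ, ∑ i, y i * (M i j : ℚ) = z) →
      ∃ (k : ℕ) (z : ℤ), (p : ℚ) ^ k * ∑ i, y i * (b i : ℚ) = z) :
    ∃ (k : ℕ) (x : Fin n → ℤ), ∀ i, ∑ j, M i j * x j = (p : ℤ) ^ k * b i := by
  let f : (Fin n → ℤ) →+ (ι → ℤ) := (Matrix.mulVecLin (Matrix.of M)).toAddMonoidHom
  have hf : ∀ x i, f x i = ∑ j, M i j * x j := fun x i => rfl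
  have step : ∀ q : ℕ, Nat.Coprime p q → ∃ (t : ℤ) (x : Fin n → ℤ), f x = (1 - t * q) • b := by
    intro q hq
    by_contra hcon
    let S : AddSubgroup (ι → ℤ) := f.range ⊔ AddSubgroup.zmultiples ((q : ℤ) • b)
    have hb : b ∉ S := by
      intro hbS
      obtain ⟨u, ⟨x, rfl⟩, v, ⟨t, rfl⟩, huv⟩ := AddSubgroup.mem_sup.1 hbS
      refine hcon ⟨t, x, ?_⟩
      rw [sub_smul, one_smul, mul_smul]
      exact eq_sub_of_add_eq huv
    obtain ⟨y, hy1, hy2⟩ := exists_rat_functional S b hb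
    obtain ⟨k, z, hz⟩ := H y (fun j => by
      obtain ⟨z, hz⟩ := hy1 (f (Pi.single j 1)) (AddSubgroup.mem_sup_left ⟨_, rfl⟩)
      refine ⟨z, ?_⟩
      rw [← hz]
      refine Finset.sum_congr rfl fun i _ => ?_
      rw [hf]; simp [Pi.single_apply])
    obtain ⟨z', hz'⟩ := hy1 ((q : ℤ) • b)
      (AddSubgroup.mem_sup_right (AddSubgroup.mem_zmultiples _))
    have hz'' : (q : ℚ) * ∑ i, y i * (b i : ℚ) = z' := by
      rw [← hz', Finset.mul_sum]
      refine Finset.sum_congr rfl fun i _ => ?_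
      simp; ring
    have hc : IsCoprime ((p ^ k : ℕ) : ℤ) (q : ℤ) :=
      Nat.isCoprime_iff_coprime.2 (Nat.Coprime.pow_left k hq)
    obtain ⟨α, β, hαβ⟩ := hc
    have hαβ' : (α : ℚ) * (p : ℚ) ^ k + β * q = 1 := by exact_mod_cast hαβ
    refine hy2 ⟨α * z + β * z', ?_⟩
    push_cast
    rw [← hz, ← hz'']
    linear_combination (-(∑ i, y i * (b i : ℚ))) * hαβ'
  have fin : ∃ N : ℕ, 0 < N ∧ ∃ x, f x = (N : ℤ) • b := by
    obtain ⟨q, hq1, hq⟩ : ∃ q : ℕ, 2 ≤ q ∧ Nat.Coprime p q :=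
      ⟨p + 1, by have := hp.two_le; omega, by simp⟩
    obtain ⟨t, x, hx⟩ := step q hq
    have hne : (1 - t * q : ℤ) ≠ 0 := by
      intro h0
      have : (q : ℤ) ∣ 1 := ⟨t, by linarith⟩
      have := Int.le_of_dvd one_pos this
      omega
    rcases Int.natAbs_eq (1 - t * q) with h1 | h1
    · exact ⟨(1 - t * q).natAbs, Int.natAbs_pos.2 hne, x, by rw [← h1, hx]⟩
    · refine ⟨(1 - t * q).natAbs, Int.natAbs_pos.2 hne, -x, ?_⟩
      rw [map_neg, hx]
      conv_lhs => rw [h1]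
      simp
  obtain ⟨N, hN, x, hx⟩ := fin
  obtain ⟨k, N', hN', hNN⟩ := Nat.exists_eq_pow_mul_and_not_dvd hN.ne' p hp.ne_one
  obtain ⟨t, x', hx'⟩ := step N' ((Nat.Prime.coprime_iff_not_dvd hp).2 hN')
  refine ⟨k, (p : ℤ) ^ k • x' + t • x, fun i => ?_⟩
  rw [← hf, map_add, map_zsmul, map_zsmul, hx, hx', hNN]
  simp
  ring

lemma exists_step {m : ℕ} (s g : Fin m → ℝ) (hs : ∀ i, 0 ≤ s i) (hg : ∀ i, s i = 0 → g i = 0) :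
    ∃ ε : ℝ, 0 < ε ∧ ∀ i, ε * g i ≤ s i := by
  have h1 : ∀ᶠ ε in nhdsWithin (0 : ℝ) (Set.Ioi 0), ∀ i, ε * g i ≤ s i := by
    rw [Filter.eventually_all]
    intro i
    rcases (hs i).eq_or_lt with h0 | h0
    · rw [hg i h0.symm, ← h0]; simp
    · have : Filter.Tendsto (fun ε : ℝ => ε * g i) (nhdsWithin 0 (Set.Ioi 0)) (nhds 0) := by
        have h2 : Continuous (fun ε : ℝ => ε * g i) := by fun_prop
        have := (h2.tendsto 0).mono_left (nhdsWithin_le_nhds (s := Set.Ioi 0))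
        simpa using this
      exact (this.eventually_lt_const h0).mono fun _ h => h.le
  obtain ⟨ε, h2, h3⟩ := (h1.and self_mem_nhdsWithin).exists
  exact ⟨ε, h3, h2⟩

lemma exists_minimal_face {m n : ℕ} (A : Matrix (Fin m) (Fin n) ℤ) (b : Fin m → ℤ)
    (c : Fin n → ℝ) (δ : ℝ)
    (hc : ∀ x : Fin n → ℝ, (∀ i, ∑ j, (A i j : ℝ) * x j ≤ (b i : ℝ)) → ∑ j, c j * x j ≤ δ)
    (hne : ∃ x : Fin n → ℝ, (∀ i, ∑ j, (A i j : ℝ) * x j ≤ (b i : ℝ)) ∧ ∑ j, c j * x j = δ) :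
    ∃ x : Fin n → ℝ, (∀ i, ∑ j, (A i j : ℝ) * x j ≤ (b i : ℝ)) ∧
      ∀ z : Fin n → ℝ, (∀ i, ∑ j, (A i j : ℝ) * x j = (b i : ℝ) →
        ∑ j, (A i j : ℝ) * z j = (b i : ℝ)) →
        (∀ i, ∑ j, (A i j : ℝ) * z j ≤ (b i : ℝ)) ∧ ∑ j, c j * z j = δ := by
  let T : (Fin n → ℝ) → Finset (Fin m) := fun x =>
    Finset.univ.filter fun i => ∑ j, (A i j : ℝ) * x j = (b i : ℝ)
  let Q : Set (Finset (Fin m)) := {I | ∃ x : Fin n → ℝ,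
    (∀ i, ∑ j, (A i j : ℝ) * x j ≤ (b i : ℝ)) ∧ ∑ j, c j * x j = δ ∧ T x = I}
  obtain ⟨x₁, hx₁, hx₁'⟩ := hne
  have hQ : Q.Nonempty := ⟨T x₁, x₁, hx₁, hx₁', rfl⟩
  obtain ⟨I, hI⟩ := (Set.toFinite Q).exists_maximal hQ
  obtain ⟨⟨x, hxP, hxδ, hxI⟩, hmax⟩ := hI
  refine ⟨x, hxP, fun z hz => ?_⟩
  have lin : ∀ (u : Fin n → ℝ) (t : ℝ), ∑ j, u j * (x j + t * (z j - x j))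
      = ∑ j, u j * x j + t * (∑ j, u j * z j - ∑ j, u j * x j) := by
    intro u t
    rw [← Finset.sum_sub_distrib, Finset.mul_sum, ← Finset.sum_add_distrib]
    exact Finset.sum_congr rfl fun j _ => by ring
  let g : Fin m → ℝ := fun i => ∑ j, (A i j : ℝ) * z j - ∑ j, (A i j : ℝ) * x j
  let s : Fin m → ℝ := fun i => b i - ∑ j, (A i j : ℝ) * x j
  have hs : ∀ i, 0 ≤ s i := fun i => sub_nonneg.2 (hxP i)
  have hg : ∀ i, s i = 0 → g i = 0 := by
    intro i hi
    have h1 : ∑ j, (A i j : ℝ) * x j = b i := (sub_eq_zero.1 hi).symm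
    show ∑ j, (A i j : ℝ) * z j - ∑ j, (A i j : ℝ) * x j = 0
    rw [h1, hz i h1, sub_self]
  have feas : ∀ t : ℝ, (∀ i, t * g i ≤ s i) →
      ∀ i, ∑ j, (A i j : ℝ) * (x j + t * (z j - x j)) ≤ b i := by
    intro t ht i
    rw [lin]
    have := ht i
    simp only [g, s] at this
    linarith
  have hcz : ∑ j, c j * z j = δ := by
    obtain ⟨ε, hε, h1⟩ := exists_step s g hs hg
    obtain ⟨ε', hε', h2⟩ := exists_step s (fun i => - g i) hs (fun i hi => by simp [hg i hi])
    have a1 := hc _ (feas ε h1)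
    have a2 := hc _ (feas (-ε') (fun i => by have := h2 i; linarith))
    rw [lin, hxδ] at a1 a2
    have b1 : ∑ j, c j * z j - δ ≤ 0 := by
      by_contra hh
      push Not at hh
      have := mul_pos hε hh
      linarith
    have b2 : 0 ≤ ∑ j, c j * z j - δ := by
      by_contra hh
      push Not at hh
      have := mul_pos_of_neg_of_neg (neg_neg_of_pos hε') hh
      linarith
    linarith
  refine ⟨?_, hcz⟩
  by_contra hbad
  push Not at hbad
  obtain ⟨i₀, hi₀⟩ := hbad
  let V : Finset (Fin m) := Finset.univ.filter fun i => 0 < g i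
  have hV : V.Nonempty := ⟨i₀, by
    simp only [V, Finset.mem_filter, Finset.mem_univ, true_and, g]
    linarith [hxP i₀]⟩
  obtain ⟨i₁, hi₁, hmin⟩ := Finset.exists_min_image V (fun i => s i / g i) hV
  have hg₁ : 0 < g i₁ := by simpa [V] using hi₁
  have hs₁ : s i₁ ≠ 0 := fun h0 => hg₁.ne' (hg _ h0)
  let t : ℝ := s i₁ / g i₁
  have ht0 : 0 ≤ t := div_nonneg (hs _) hg₁.le
  have ht : ∀ i, t * g i ≤ s i := by
    intro i
    by_cases hi : 0 < g i
    · have := hmin i (by simp [V, hi])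
      exact (le_div_iff₀ hi).1 this
    · exact (mul_nonpos_of_nonneg_of_nonpos ht0 (not_lt.1 hi)).trans (hs i)
  have hmem : T (fun j => x j + t * (z j - x j)) ∈ Q :=
    ⟨_, feas t ht, by rw [lin, hcz, hxδ]; ring, rfl⟩
  have hle : I ≤ T (fun j => x j + t * (z j - x j)) := by
    intro i hi
    rw [← hxI] at hi
    have h1 : ∑ j, (A i j : ℝ) * x j = b i := by simpa [T] using hi
    simp only [T, Finset.mem_filter, Finset.mem_univ, true_and]
    rw [lin, hz i h1, h1]; ring
  have h2 := hmax hmem hle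
  have h3 : i₁ ∈ T (fun j => x j + t * (z j - x j)) := by
    simp only [T, Finset.mem_filter, Finset.mem_univ, true_and]
    rw [lin]
    have : t * g i₁ = s i₁ := div_mul_cancel₀ _ hg₁.ne'
    simp only [g, s] at this ⊢
    linarith
  have h4 := h2 h3
  rw [← hxI] at h4
  have h5 : ∑ j, (A i₁ j : ℝ) * x j = b i₁ := by simpa [T] using h4
  exact hs₁ (by simp only [s]; rw [h5, sub_self])

lemma padic_sum_int {p : ℕ} (hp : p.Prime) {m : ℕ} (b : Fin m → ℤ) (y : Fin m → ℝ)
    (hy : ∀ i, IsPadic p (y i)) :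
    ∃ (k : ℕ) (z : ℤ), (p : ℝ) ^ k * ∑ i, (b i : ℝ) * y i = z := by
  have hp0 : (p : ℝ) ≠ 0 := by exact_mod_cast hp.ne_zero
  choose a k hak using hy
  refine ⟨∑ i, k i, ∑ i, b i * a i * (p : ℤ) ^ (∑ l, k l - k i), ?_⟩
  rw [Finset.mul_sum]
  push_cast
  refine Finset.sum_congr rfl fun i _ => ?_
  have hle : k i ≤ ∑ l, k l := Finset.single_le_sum (f := k) (fun _ _ => Nat.zero_le _) (Finset.mem_univ i)
  have : (p : ℝ) ^ (∑ l, k l) = (p : ℝ) ^ (∑ l, k l - k i) * (p : ℝ) ^ k i := by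
    rw [← pow_add, Nat.sub_add_cancel hle]
  rw [this, hak i]
  field_simp

/-- If `Ax ≤ b` is totally dual `p`-adic, then `{x : Ax ≤ b}` is a
`p`-adic polyhedron: every nonempty face contains a `p`-adic point. -/
theorem totally_dual_padic_implies_padic_polyhedron {m n : ℕ} (p : ℕ) (hp : p.Prime)
    (A : Matrix (Fin m) (Fin n) ℤ) (b : Fin m → ℤ)
    (h : TotallyDualPadic p A b) :
    ∀ F : Set (Fin n → ℝ),
      IsFace {x | ∀ i, ∑ j, (A i j : ℝ) * x j ≤ (b i : ℝ)} F → F.Nonempty →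
      ∃ x ∈ F, ∀ j, IsPadic p (x j) := by
  rintro F ⟨c, δ, hc, rfl⟩ ⟨x₁, hx₁, hx₁'⟩
  obtain ⟨x, hxP, hx⟩ := exists_minimal_face A b c δ hc ⟨x₁, hx₁, hx₁'⟩
  have hp0 : (p : ℝ) ≠ 0 := by exact_mod_cast hp.ne_zero
  let I : Fin m → Prop := fun i => ∑ j, (A i j : ℝ) * x j = (b i : ℝ)
  have weak : ∀ (w : Fin n → ℤ) (y : Fin m → ℝ), DualFeasible A w y →
      ∑ i, y i * (∑ j, (A i j : ℝ) * x j) = ∑ j, (w j : ℝ) * x j := by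
    intro w y hy
    simp only [Finset.mul_sum]
    rw [Finset.sum_comm]
    refine Finset.sum_congr rfl fun j _ => ?_
    rw [← hy.2 j, Finset.sum_mul]
    exact Finset.sum_congr rfl fun i _ => by ring
  obtain ⟨k, u, hu⟩ := exists_scaled_solution (ι := Fin m) hp
      (fun i j => if I i then A i j else 0) (fun i => if I i then b i else 0) (by
    intro y hy
    choose w hw using hy
    obtain ⟨N, hN⟩ : ∃ N : ℕ, ∀ i, 0 ≤ y i + N := by
      obtain ⟨N, hN⟩ := exists_nat_ge (∑ i, |y i|)
      refine ⟨N, fun i => ?_⟩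
      have h1 := Finset.single_le_sum (f := fun i => |y i|) (fun _ _ => abs_nonneg _)
        (Finset.mem_univ i)
      have h2 := neg_abs_le (y i)
      linarith
    let y' : Fin m → ℝ := fun i => if I i then ((y i + N : ℚ) : ℝ) else 0
    let w' : Fin n → ℤ := fun j => w j + N * ∑ i, if I i then A i j else 0
    have hfeas : DualFeasible A w' y' := by
      refine ⟨fun i => ?_, fun j => ?_⟩
      · simp only [y']
        split_ifs
        · exact_mod_cast hN i
        · exact le_rfl
      · have h1 : ((∑ i, y i * ((if I i then A i j else 0 : ℤ) : ℚ) : ℚ) : ℝ) = ((w j : ℚ) : ℝ) := by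
          rw [hw j]
        simp only [w']
        push_cast at h1 ⊢
        rw [← h1, Finset.mul_sum, ← Finset.sum_add_distrib]
        refine Finset.sum_congr rfl fun i _ => ?_
        simp only [y']
        split_ifs
        · push_cast; ring
        · simp
    have hval : ∑ i, (b i : ℝ) * y' i = ∑ j, (w' j : ℝ) * x j := by
      rw [← weak w' y' hfeas]
      refine Finset.sum_congr rfl fun i _ => ?_
      by_cases hi : I i
      · have : ∑ j, (A i j : ℝ) * x j = (b i : ℝ) := hi
        rw [this]; ring
      · simp [y', hi]
    have hopt : DualOptimal A b w' y' := by
      refine ⟨hfeas, fun y'' hy'' => ?_⟩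
      rw [hval, ← weak w' y'' hy'']
      refine Finset.sum_le_sum fun i _ => ?_
      rw [mul_comm (b i : ℝ)]
      exact mul_le_mul_of_nonneg_left (hxP i) (hy''.1 i)
    obtain ⟨y'', hy'', hpad⟩ := h w' ⟨y', hopt⟩
    have heq : ∑ i, (b i : ℝ) * y'' i = ∑ i, (b i : ℝ) * y' i :=
      le_antisymm (hy''.2 _ hfeas) (hopt.2 _ hy''.1)
    obtain ⟨k, z, hz⟩ := padic_sum_int hp b y'' hpad
    refine ⟨k, z - (p : ℤ) ^ k * (N * ∑ i, if I i then b i else 0), ?_⟩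
    have h2 : ∑ i, (b i : ℝ) * y' i
        = ((∑ i, y i * ((if I i then b i else 0 : ℤ) : ℚ) : ℚ) : ℝ)
          + N * ((∑ i, if I i then b i else 0 : ℤ) : ℝ) := by
      push_cast
      rw [Finset.mul_sum, ← Finset.sum_add_distrib]
      refine Finset.sum_congr rfl fun i _ => ?_
      simp only [y']
      split_ifs
      · push_cast; ring
      · simp
    rw [heq, h2] at hz
    have h3 : (((p : ℚ) ^ k * ∑ i, y i * ((if I i then b i else 0 : ℤ) : ℚ) : ℚ) : ℝ)
        = ((z - (p : ℤ) ^ k * (N * ∑ i, if I i then b i else 0) : ℤ) : ℚ) := by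
      rw [Rat.cast_mul, Rat.cast_intCast, Int.cast_sub, Int.cast_mul, Int.cast_mul, ← hz]
      push_cast
      ring
    exact_mod_cast h3)
  have hfin := hx (fun j => (u j : ℝ) / (p : ℝ) ^ k) (by
    intro i hi
    have h1 := hu i
    have hI : I i := hi
    simp only [hI, if_true] at h1
    have h2 : ∑ j, (A i j : ℝ) * (u j : ℝ) = (p : ℝ) ^ k * b i := by exact_mod_cast h1
    have h3 : ∑ j, (A i j : ℝ) * ((u j : ℝ) / (p : ℝ) ^ k)
        = (∑ j, (A i j : ℝ) * (u j : ℝ)) / (p : ℝ) ^ k := by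
      rw [Finset.sum_div]
      exact Finset.sum_congr rfl fun j _ => by ring
    rw [h3, h2]
    field_simp)
  exact ⟨fun j => (u j : ℝ) / (p : ℝ) ^ k, ⟨hfin.1, hfin.2⟩, fun j => ⟨u j, k, rfl⟩⟩
end
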